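/- For integers ℓ, k ≥ 2, the length of the shortest negative cycle of the signed bipartite graph BM̂(ℓ, 2k) equals min{2ℓ+2, 2k}; in particular BM̂(k−1, 2k) has 2k²−k+1 vertices and shortest negative cycle length 2k. -/

import Mathlib

open scoped Classical

/-- Adjacency relation of the cylindrical grid `C_{ℓ×m}`: vertex `v_{i,j}` is adjacent to
`v_{i+1,j-1}` and `v_{i+1,j}` (second index mod `m`). -/
def gridRel (ℓ m : ℕ) (x y : Fin ℓ × ZMod m) : Prop :=
  (y.1 : ℕ) = (x.1 : ℕ) + 1 ∧ (y.2 = x.2 - 1 ∨ y.2 = x.2)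

/-- Vertices of `BM̂(ℓ, 2k)`: the grid vertices `v_{i,j}` and the universal vertex `u`
(as `Sum.inl`, with `u = Sum.inl none`), together with the extra vertices `u_1, …, u_k`
(as `Sum.inr`). -/
abbrev BMVert (ℓ k : ℕ) := Option (Fin ℓ × ZMod (2 * k)) ⊕ Fin k

/-- The positive edges of `BM̂(ℓ, 2k)`: `u_i` is joined to `v_{1,i+k}` and `v_{1,i+k+1}` by
positive edges. -/
def bmPos (ℓ k : ℕ) : BMVert ℓ k → BMVert ℓ k → Prop
  | Sum.inr i, Sum.inl (some y) =>
      (y.1 : ℕ) = 0 ∧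
        (y.2 = ((i : ℕ) : ZMod (2 * k)) + (k : ZMod (2 * k)) ∨
          y.2 = ((i : ℕ) : ZMod (2 * k)) + (k : ZMod (2 * k)) + 1)
  | _, _ => False

/-- Generating relation for the signed bipartite graph `BM̂(ℓ, 2k)`: the cylindrical grid
`C_{ℓ×2k}` with all edges negative, a universal vertex `u` joined by negative edges to all
last-layer vertices `v_{ℓ,j}`, and vertices `u_1, …, u_k` where `u_i` is joined to `v_{1,i}`
and `v_{1,i+1}` by negative edges and to `v_{1,i+k}` and `v_{1,i+k+1}` by positive edges. -/
def bmRel (ℓ k : ℕ) : BMVert ℓ k → BMVert ℓ k → Prop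
  | Sum.inl (some x), Sum.inl (some y) => gridRel ℓ (2 * k) x y
  | Sum.inl (some x), Sum.inl none => (x.1 : ℕ) = ℓ - 1
  | Sum.inr i, Sum.inl (some y) =>
      (y.1 : ℕ) = 0 ∧
        (y.2 = ((i : ℕ) : ZMod (2 * k)) ∨ y.2 = ((i : ℕ) : ZMod (2 * k)) + 1 ∨
          y.2 = ((i : ℕ) : ZMod (2 * k)) + (k : ZMod (2 * k)) ∨
          y.2 = ((i : ℕ) : ZMod (2 * k)) + (k : ZMod (2 * k)) + 1)
  | _, _ => False

/-- The underlying graph of the signed bipartite graph `BM̂(ℓ, 2k)`. -/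
def BMGraph (ℓ k : ℕ) : SimpleGraph (BMVert ℓ k) :=
  SimpleGraph.fromRel (bmRel ℓ k)

/-- The number of negative edges along a closed walk `w` of a signed graph whose positive
edges are those `uv` with `pos u v ∨ pos v u`. -/
noncomputable def negEdgeCount {V : Type*} {G : SimpleGraph V} (pos : V → V → Prop)
    {v : V} (w : G.Walk v v) : ℕ :=
  (w.darts.filter
    (fun d => decide (¬ (pos d.toProd.1 d.toProd.2 ∨ pos d.toProd.2 d.toProd.1)))).length

/-! ### General walk lemmas -/

theorem bm_walk_height {V : Type*} {G : SimpleGraph V} (f : V → ℤ)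
    (hf : ∀ a b, G.Adj a b → f b = f a + 1 ∨ f b = f a - 1) {a b : V} (w : G.Walk a b) :
    |f b - f a| ≤ w.length ∧ (2 : ℤ) ∣ (w.length - (f b - f a)) := by
  induction w with
  | nil => simp
  | cons h p ih =>
    rename_i u v x
    obtain ⟨h1, h2⟩ := ih
    rw [abs_le] at *
    rw [SimpleGraph.Walk.length_cons]
    push_cast
    rcases hf _ _ h with h | h <;> refine ⟨⟨?_, ?_⟩, ?_⟩ <;> omega

theorem bm_seq_walk {V : Type*} {G : SimpleGraph V} (pos : V → V → Prop) (m : ℕ) :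
    ∀ (f : ℕ → V), (∀ i < m, G.Adj (f i) (f (i + 1)) ∧
      ¬ (pos (f i) (f (i + 1)) ∨ pos (f (i + 1)) (f i))) →
    ∃ p : G.Walk (f 0) (f m), p.length = m ∧ p.support = (List.range (m + 1)).map f ∧
      (p.darts.filter (fun d => decide
        (¬ (pos d.toProd.1 d.toProd.2 ∨ pos d.toProd.2 d.toProd.1)))).length = m ∧
      ∀ e ∈ p.edges, ∃ i < m, e = s(f i, f (i + 1)) := by
  induction m with
  | zero => intro f _; exact ⟨SimpleGraph.Walk.nil, by simp⟩
  | succ m ih =>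
    intro f hf
    obtain ⟨p, h1, h2, h3, h4⟩ := ih (fun i => f (i + 1)) (fun i hi => hf (i + 1) (by omega))
    refine ⟨SimpleGraph.Walk.cons (hf 0 (by omega)).1 p, ?_, ?_, ?_, ?_⟩
    · simp [h1]
    · rw [SimpleGraph.Walk.support_cons, h2, List.range_succ_eq_map (n := m + 1)]
      simp [Function.comp_def]
    · rw [SimpleGraph.Walk.darts_cons, List.filter_cons_of_pos]
      · rw [List.length_cons, h3]
      · simpa using (hf 0 (by omega)).2
    · intro e he
      rw [SimpleGraph.Walk.edges_cons, List.mem_cons] at he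
      rcases he with rfl | he
      · exact ⟨0, by omega, rfl⟩
      · obtain ⟨i, hi, rfl⟩ := h4 e he
        exact ⟨i + 1, by omega, rfl⟩

theorem bm_seq_cycle {V : Type*} {G : SimpleGraph V} (pos : V → V → Prop) (m : ℕ) (hm : 2 ≤ m)
    (f : ℕ → V) (hf : ∀ i < m, G.Adj (f i) (f (i + 1)) ∧
      ¬ (pos (f i) (f (i + 1)) ∨ pos (f (i + 1)) (f i)))
    (hinj : ∀ i j, i ≤ m → j ≤ m → f i = f j → i = j)
    (hadj : G.Adj (f m) (f 0)) (hpos : pos (f 0) (f m)) (hodd : Odd m) :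
    ∃ (v : V) (w : G.Walk v v), w.IsCycle ∧ Odd (negEdgeCount pos w) ∧ w.length = m + 1 := by
  obtain ⟨p, h1, h2, h3, h4⟩ := bm_seq_walk (G := G) pos m f hf
  refine ⟨f m, SimpleGraph.Walk.cons hadj p, ?_, ?_, by simp [h1]⟩
  · rw [SimpleGraph.Walk.cons_isCycle_iff]
    constructor
    · rw [SimpleGraph.Walk.isPath_def, h2]
      refine List.Nodup.map_on ?_ List.nodup_range
      intro x hx y hy hxy
      rw [List.mem_range] at hx hy
      exact hinj x y (by omega) (by omega) hxy
    · intro he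
      obtain ⟨i, hi, he⟩ := h4 _ he
      rw [Sym2.eq_iff] at he
      rcases he with ⟨a, b⟩ | ⟨a, b⟩
      · have := hinj _ _ (by omega) (by omega) a
        omega
      · have := hinj _ _ (by omega) (by omega) a
        have := hinj _ _ (by omega) (by omega) b
        omega
  · unfold negEdgeCount
    rw [SimpleGraph.Walk.darts_cons, List.filter_cons_of_neg, h3]
    · exact hodd
    · simp [hpos]

theorem bm_cast_ne (k a b : ℕ) (ha : a < 2 * k) (hb : b < 2 * k) (hab : a ≠ b) :
    ((a : ℕ) : ZMod (2 * k)) ≠ (b : ℕ) := by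
  intro h
  rw [ZMod.natCast_eq_natCast_iff', Nat.mod_eq_of_lt ha, Nat.mod_eq_of_lt hb] at h
  exact hab h

/-! ### The two short negative cycles -/

theorem bm_cycle_one (ℓ k : ℕ) (hℓ : 1 ≤ ℓ) (hk : 2 ≤ k) :
    ∃ (v : BMVert ℓ k) (w : (BMGraph ℓ k).Walk v v),
        w.IsCycle ∧ Odd (negEdgeCount (bmPos ℓ k) w) ∧ w.length = 2 * k := by
  have hk0 : 0 < k := by omega
  let f : ℕ → BMVert ℓ k := fun n =>
    if n % 2 = 0 then Sum.inr ⟨n / 2 % k, Nat.mod_lt _ hk0⟩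
    else Sum.inl (some (⟨0, hℓ⟩, ((n / 2 + 1 : ℕ) : ZMod (2 * k))))
  have fe : ∀ i (hi : i < k), f (2 * i) = Sum.inr ⟨i, hi⟩ := by
    intro i hi
    have h1 : 2 * i % 2 = 0 := by omega
    have h2 : 2 * i / 2 = i := by omega
    simp only [f, h1, if_true, h2, Nat.mod_eq_of_lt hi]
  have fo : ∀ i, f (2 * i + 1) = Sum.inl (some (⟨0, hℓ⟩, ((i + 1 : ℕ) : ZMod (2 * k)))) := by
    intro i
    have h1 : ¬ (2 * i + 1) % 2 = 0 := by omega
    have h2 : (2 * i + 1) / 2 = i := by omega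
    simp only [f, h1, if_false, h2]
  have k1 : (k : ZMod (2 * k)) ≠ 1 := by
    simpa using bm_cast_ne k k 1 (by omega) (by omega) (by omega)
  have k0 : (k : ZMod (2 * k)) ≠ 0 := by
    simpa using bm_cast_ne k k 0 (by omega) (by omega) (by omega)
  have k2 : (k : ZMod (2 * k)) + 1 ≠ 0 := by
    simpa using bm_cast_ne k (k + 1) 0 (by omega) (by omega) (by omega)
  have := bm_seq_cycle (G := BMGraph ℓ k) (bmPos ℓ k) (2 * k - 1) (by omega) f ?_ ?_ ?_ ?_ ?_
  · rwa [show 2 * k - 1 + 1 = 2 * k by omega] at this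
  · intro n hn
    obtain ⟨i, rfl | rfl⟩ : ∃ i, n = 2 * i ∨ n = 2 * i + 1 := ⟨n / 2, by omega⟩
    · rw [fe i (by omega), fo i]
      refine ⟨?_, ?_⟩
      · simp [BMGraph, bmRel]
      · simp only [bmPos, or_false, true_and, not_or]
        push_cast
        constructor
        · intro h
          exact k1 (add_left_cancel h).symm
        · intro h
          apply k0
          linear_combination -h
    · rw [fo i, show 2 * i + 1 + 1 = 2 * (i + 1) by ring, fe (i + 1) (by omega)]
      refine ⟨?_, ?_⟩
      · simp [BMGraph, bmRel]
      · simp only [bmPos, false_or, true_and, not_or]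
        push_cast
        constructor
        · intro h
          apply k0
          linear_combination -h
        · intro h
          apply k2
          linear_combination -h
  · intro a b ha hb hab
    obtain ⟨i, rfl | rfl⟩ : ∃ i, a = 2 * i ∨ a = 2 * i + 1 := ⟨a / 2, by omega⟩ <;>
    obtain ⟨j, rfl | rfl⟩ : ∃ j, b = 2 * j ∨ b = 2 * j + 1 := ⟨b / 2, by omega⟩
    · rw [fe i (by omega), fe j (by omega)] at hab
      simp at hab
      omega
    · rw [fe i (by omega), fo] at hab
      simp at hab
    · rw [fo, fe j (by omega)] at hab
      simp at hab
    · rw [fo, fo] at hab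
      by_contra hne
      refine bm_cast_ne k (i + 1) (j + 1) (by omega) (by omega) (by omega) ?_
      simpa only [Sum.inl.injEq, Option.some.injEq, Prod.mk.injEq, true_and] using hab
  · rw [show f 0 = f (2 * 0) from rfl, fe 0 hk0,
      show 2 * k - 1 = 2 * (k - 1) + 1 by omega, fo, show k - 1 + 1 = k by omega]
    simp [BMGraph, bmRel]
  · rw [show f 0 = f (2 * 0) from rfl, fe 0 hk0,
      show 2 * k - 1 = 2 * (k - 1) + 1 by omega, fo, show k - 1 + 1 = k by omega]
    simp [bmPos]
  · exact ⟨k - 1, by omega⟩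

theorem bm_cycle_two (ℓ k : ℕ) (hℓ : 1 ≤ ℓ) (hk : 2 ≤ k) :
    ∃ (v : BMVert ℓ k) (w : (BMGraph ℓ k).Walk v v),
        w.IsCycle ∧ Odd (negEdgeCount (bmPos ℓ k) w) ∧ w.length = 2 * ℓ + 2 := by
  have hk0 : 0 < k := by omega
  let f : ℕ → BMVert ℓ k := fun n =>
    if n = 0 then Sum.inr ⟨0, hk0⟩
    else if h : n ≤ ℓ then Sum.inl (some (⟨n - 1, by omega⟩, 0))
    else if h' : n = ℓ + 1 then Sum.inl none
    else Sum.inl (some (⟨2 * ℓ + 1 - n, by omega⟩, (k : ZMod (2 * k))))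
  have f0 : f 0 = Sum.inr ⟨0, hk0⟩ := rfl
  have f1 : ∀ i (hi : i < ℓ), f (i + 1) = Sum.inl (some (⟨i, hi⟩, 0)) := by
    intro i hi
    simp [f, show i + 1 ≤ ℓ by omega]
  have f2 : f (ℓ + 1) = Sum.inl none := by simp [f]
  have f3 : ∀ i (hi : i < ℓ), f (2 * ℓ + 1 - i) =
      Sum.inl (some (⟨i, hi⟩, (k : ZMod (2 * k)))) := by
    intro i hi
    simp only [f]
    rw [if_neg (by omega), dif_neg (by omega), dif_neg (by omega)]
    congr
    omega
  have k1 : (k : ZMod (2 * k)) ≠ 1 := by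
    simpa using bm_cast_ne k k 1 (by omega) (by omega) (by omega)
  have k0 : (k : ZMod (2 * k)) ≠ 0 := by
    simpa using bm_cast_ne k k 0 (by omega) (by omega) (by omega)
  have k2 : (k : ZMod (2 * k)) + 1 ≠ 0 := by
    simpa using bm_cast_ne k (k + 1) 0 (by omega) (by omega) (by omega)
  have cases4 : ∀ n ≤ 2 * ℓ + 1, n = 0 ∨ (∃ i, i < ℓ ∧ n = i + 1) ∨ n = ℓ + 1 ∨
      ∃ i, i < ℓ ∧ n = 2 * ℓ + 1 - i := by
    intro n hn
    by_cases h0 : n = 0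
    · exact Or.inl h0
    by_cases h1 : n ≤ ℓ
    · exact Or.inr (Or.inl ⟨n - 1, by omega, by omega⟩)
    by_cases h2 : n = ℓ + 1
    · exact Or.inr (Or.inr (Or.inl h2))
    · exact Or.inr (Or.inr (Or.inr ⟨2 * ℓ + 1 - n, by omega, by omega⟩))
  refine bm_seq_cycle (G := BMGraph ℓ k) (bmPos ℓ k) (2 * ℓ + 1) (by omega) f ?_ ?_ ?_ ?_ ?_
  · intro n hn
    rcases cases4 n (by omega) with rfl | ⟨i, hi, rfl⟩ | rfl | ⟨i, hi, rfl⟩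
    · rw [f0, f1 0 hℓ]
      refine ⟨by simp [BMGraph, bmRel], ?_⟩
      simp [bmPos, k0.symm, k2.symm]
    · by_cases h : i + 1 = ℓ
      · rw [f1 i hi, show i + 1 + 1 = ℓ + 1 by omega, f2]
        refine ⟨?_, by simp [bmPos]⟩
        simp [BMGraph, bmRel]
        omega
      · rw [f1 i hi, f1 (i + 1) (by omega)]
        refine ⟨?_, by simp [bmPos]⟩
        simp [BMGraph, bmRel, gridRel]
    · rw [f2, show ℓ + 1 + 1 = 2 * ℓ + 1 - (ℓ - 1) by omega, f3 _ (by omega)]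
      refine ⟨?_, by simp [bmPos]⟩
      simp [BMGraph, bmRel]
    · obtain ⟨j, rfl⟩ : ∃ j, i = j + 1 := ⟨i - 1, by omega⟩
      rw [f3 _ hi, show 2 * ℓ + 1 - (j + 1) + 1 = 2 * ℓ + 1 - j by omega, f3 j (by omega)]
      refine ⟨?_, by simp [bmPos]⟩
      simp [BMGraph, bmRel, gridRel]
  · intro a b ha hb hab
    rcases cases4 a ha with rfl | ⟨i, hi, rfl⟩ | rfl | ⟨i, hi, rfl⟩ <;>
    rcases cases4 b hb with rfl | ⟨j, hj, rfl⟩ | rfl | ⟨j, hj, rfl⟩ <;>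
    simp (disch := assumption) [f0, f1, f2, f3, k0, k0.symm] at hab ⊢ <;> omega
  · rw [f0, show 2 * ℓ + 1 = 2 * ℓ + 1 - 0 by omega, f3 0 hℓ]
    simp [BMGraph, bmRel]
  · rw [f0, show 2 * ℓ + 1 = 2 * ℓ + 1 - 0 by omega, f3 0 hℓ]
    simp [bmPos]
  · exact ⟨ℓ, rfl⟩

/-! ### Lower bound -/

/-- The layer of a vertex. -/
def bmLayer (ℓ k : ℕ) : BMVert ℓ k → ℤ
  | Sum.inr _ => 0
  | Sum.inl none => ℓ + 1
  | Sum.inl (some x) => ((x.1 : ℕ) : ℤ) + 1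

theorem bmLayer_adj (ℓ k : ℕ) (hℓ : 1 ≤ ℓ) (a b : BMVert ℓ k) (h : (BMGraph ℓ k).Adj a b) :
    bmLayer ℓ k b = bmLayer ℓ k a + 1 ∨ bmLayer ℓ k b = bmLayer ℓ k a - 1 := by
  rw [BMGraph, SimpleGraph.fromRel_adj] at h
  obtain ⟨-, h⟩ := h
  rcases a with (_ | a) | a <;> rcases b with (_ | b) | b <;>
    simp only [bmRel, gridRel, or_false, false_or, or_self] at h <;>
    simp only [bmLayer] <;> omega

/-- The doubling homomorphism. -/
def bmDbl (k : ℕ) : ZMod (2 * k) →+ ZMod (4 * k) :=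
  ZMod.lift (2 * k) ⟨zmultiplesHom (ZMod (4 * k)) 2, by
    have : ((4 * k : ℕ) : ZMod (4 * k)) = 0 := ZMod.natCast_self _
    simp only [zmultiplesHom_apply, zsmul_eq_mul]
    push_cast at this ⊢
    linear_combination this⟩

theorem bmDbl_cast (k n : ℕ) : bmDbl k (n : ZMod (2 * k)) = 2 * (n : ZMod (4 * k)) := by
  have := ZMod.lift_coe (2 * k) (⟨zmultiplesHom (ZMod (4 * k)) 2, by
    have : ((4 * k : ℕ) : ZMod (4 * k)) = 0 := ZMod.natCast_self _
    simp only [zmultiplesHom_apply, zsmul_eq_mul]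
    push_cast at this ⊢
    linear_combination this⟩ : {f : ℤ →+ ZMod (4 * k) // f ((2 * k : ℕ) : ℤ) = 0}) (n : ℤ)
  simp only [zmultiplesHom_apply, zsmul_eq_mul, Int.cast_natCast] at this
  rw [bmDbl]
  exact this.trans (mul_comm _ _)

/-- The angular position of a vertex. -/
def bmAng (ℓ k : ℕ) : BMVert ℓ k → ZMod (4 * k)
  | Sum.inr i => 2 * ((i : ℕ) : ZMod (4 * k)) + 1
  | Sum.inl none => 0
  | Sum.inl (some x) => bmDbl k x.2 + ((x.1 : ℕ) : ZMod (4 * k))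

theorem bmAng_rel (ℓ k : ℕ) (a b : BMVert ℓ k) (h : bmRel ℓ k a b)
    (hb : b ≠ Sum.inl none) :
    ∃ s : ℤ, (s = 1 ∨ s = -1) ∧
      (bmPos ℓ k a b → bmAng ℓ k b = bmAng ℓ k a + s + 2 * k) ∧
      (¬ bmPos ℓ k a b → bmAng ℓ k b = bmAng ℓ k a + s) := by
  have d1 : bmDbl k 1 = 2 := by simpa using bmDbl_cast k 1
  rcases a with (_ | ⟨a1, a2⟩) | i <;> rcases b with (_ | ⟨b1, b2⟩) | j <;>
    simp only [bmRel, gridRel] at h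
  · exact absurd rfl hb
  · obtain ⟨h1, rfl | rfl⟩ := h
    · exact ⟨-1, by simp, by simp [bmPos], fun _ => by
        simp only [bmAng, h1, map_sub, d1]; push_cast; ring⟩
    · exact ⟨1, by simp, by simp [bmPos], fun _ => by
        simp only [bmAng, h1]; push_cast; ring⟩
  · obtain ⟨h1, h2⟩ := h
    by_cases hp : bmPos ℓ k (Sum.inr i) (Sum.inl (some (b1, b2)))
    · obtain ⟨-, rfl | rfl⟩ := id hp
      · exact ⟨-1, by simp, fun _ => by
          simp only [bmAng, h1, map_add, d1, bmDbl_cast]; push_cast; ring, fun h => absurd hp h⟩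
      · exact ⟨1, by simp, fun _ => by
          simp only [bmAng, h1, map_add, d1, bmDbl_cast]; push_cast; ring, fun h => absurd hp h⟩
    · have : b2 = ((i : ℕ) : ZMod (2 * k)) ∨ b2 = ((i : ℕ) : ZMod (2 * k)) + 1 := by
        simp only [bmPos, h1, true_and] at hp
        tauto
      rcases this with rfl | rfl
      · exact ⟨-1, by simp, fun h => absurd h hp, fun _ => by
          simp only [bmAng, h1, map_add, d1, bmDbl_cast]; push_cast; ring⟩
      · exact ⟨1, by simp, fun h => absurd h hp, fun _ => by
          simp only [bmAng, h1, map_add, d1, bmDbl_cast]; push_cast; ring⟩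

theorem bmPos_rel (ℓ k : ℕ) (a b : BMVert ℓ k) (h : bmPos ℓ k a b) : bmRel ℓ k a b := by
  rcases a with (_ | ⟨a1, a2⟩) | i <;> rcases b with (_ | ⟨b1, b2⟩) | j <;>
    simp only [bmPos, bmRel] at h ⊢
  tauto

theorem bmRel_asymm (ℓ k : ℕ) (a b : BMVert ℓ k) (h : bmRel ℓ k a b) : ¬ bmRel ℓ k b a := by
  rcases a with (_ | ⟨a1, a2⟩) | i <;> rcases b with (_ | ⟨b1, b2⟩) | j <;>
    simp only [bmRel, gridRel, not_false_eq_true] at h ⊢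
  omega

theorem bmAng_adj (ℓ k : ℕ) (a b : BMVert ℓ k) (h : (BMGraph ℓ k).Adj a b)
    (ha : a ≠ Sum.inl none) (hb : b ≠ Sum.inl none) :
    ∃ s : ℤ, (s = 1 ∨ s = -1) ∧
      ((bmPos ℓ k a b ∨ bmPos ℓ k b a) → bmAng ℓ k b = bmAng ℓ k a + s + 2 * k) ∧
      (¬ (bmPos ℓ k a b ∨ bmPos ℓ k b a) → bmAng ℓ k b = bmAng ℓ k a + s) := by
  rw [BMGraph, SimpleGraph.fromRel_adj] at h
  have h4 : (4 * k : ZMod (4 * k)) = 0 := by exact_mod_cast ZMod.natCast_self (4 * k)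
  rcases h.2 with h | h
  · have hn : ¬ bmPos ℓ k b a := fun h' => bmRel_asymm _ _ _ _ h (bmPos_rel _ _ _ _ h')
    simpa only [hn, or_false] using bmAng_rel ℓ k a b h hb
  · have hn : ¬ bmPos ℓ k a b := fun h' => bmRel_asymm _ _ _ _ h (bmPos_rel _ _ _ _ h')
    obtain ⟨s, hs, h1, h2⟩ := bmAng_rel ℓ k b a h ha
    refine ⟨-s, by omega, ?_, ?_⟩
    · simp only [hn, false_or]
      intro hp
      push_cast
      linear_combination -(h1 hp) - h4
    · simp only [hn, false_or]
      intro hp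
      push_cast
      linear_combination -(h2 hp)

theorem bmAng_walk (ℓ k : ℕ) {a b : BMVert ℓ k} (w : (BMGraph ℓ k).Walk a b)
    (hw : Sum.inl none ∉ w.support) :
    ∃ (s : ℤ) (p : ℕ), |s| ≤ w.length ∧ (2 : ℤ) ∣ (w.length - s) ∧
      w.length = p + (w.darts.filter (fun d => decide
        (¬ (bmPos ℓ k d.toProd.1 d.toProd.2 ∨ bmPos ℓ k d.toProd.2 d.toProd.1)))).length ∧
      bmAng ℓ k b = bmAng ℓ k a + s + 2 * k * p := by
  induction w with
  | nil => exact ⟨0, 0, by simp⟩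
  | cons h q ih =>
    rename_i x y z
    rw [SimpleGraph.Walk.support_cons, List.mem_cons, not_or] at hw
    obtain ⟨s, p, h1, h2, h3, h4⟩ := ih hw.2
    have hy : y ≠ Sum.inl none := by
      rintro rfl
      exact hw.2 q.start_mem_support
    obtain ⟨t, ht, h5, h6⟩ := bmAng_adj ℓ k x y h (Ne.symm hw.1) hy
    rw [abs_le] at h1
    rw [SimpleGraph.Walk.darts_cons, SimpleGraph.Walk.length_cons]
    by_cases hp : bmPos ℓ k x y ∨ bmPos ℓ k y x
    · refine ⟨s + t, p + 1, ?_, ?_, ?_, ?_⟩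
      · rw [abs_le]; push_cast; omega
      · push_cast; omega
      · rw [List.filter_cons_of_neg (by simp only [decide_eq_true_eq]; exact not_not_intro hp)]
        omega
      · push_cast
        linear_combination h4 + h5 hp
    · refine ⟨s + t, p, ?_, ?_, ?_, ?_⟩
      · rw [abs_le]; push_cast; omega
      · push_cast; omega
      · rw [List.filter_cons_of_pos (by simpa using hp), List.length_cons]
        omega
      · push_cast
        linear_combination h4 + h6 hp

theorem bm_lower (ℓ k : ℕ) (hℓ : 1 ≤ ℓ) {v : BMVert ℓ k}
    (w : (BMGraph ℓ k).Walk v v) (hodd : Odd (negEdgeCount (bmPos ℓ k) w)) :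
    min (2 * ℓ + 2) (2 * k) ≤ w.length := by
  by_cases hu : Sum.inl none ∈ w.support
  · refine (min_le_left _ _).trans ?_
    by_cases hi : ∃ i : Fin k, Sum.inr i ∈ w.support
    · obtain ⟨i, hi⟩ := hi
      have hi' : Sum.inr i ∈ (w.rotate _ hu).support := by
        rw [SimpleGraph.Walk.mem_support_rotate_iff]
        exact hi
      have e1 := congrArg SimpleGraph.Walk.length ((w.rotate _ hu).take_spec hi')
      rw [SimpleGraph.Walk.length_append, SimpleGraph.Walk.length_rotate] at e1
      have e2 := (bm_walk_height _ (bmLayer_adj ℓ k hℓ) ((w.rotate _ hu).takeUntil _ hi')).1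
      have e3 := (bm_walk_height _ (bmLayer_adj ℓ k hℓ) ((w.rotate _ hu).dropUntil _ hi')).1
      simp only [bmLayer, abs_le] at e2 e3
      omega
    · exfalso
      push Not at hi
      have h2 := (bm_walk_height _ (bmLayer_adj ℓ k hℓ) w).2
      have : negEdgeCount (bmPos ℓ k) w = w.length := by
        rw [negEdgeCount, List.filter_eq_self.2, SimpleGraph.Walk.length_darts]
        intro d hd
        have a1 := w.dart_fst_mem_support_of_mem_darts hd
        have a2 := w.dart_snd_mem_support_of_mem_darts hd
        rcases d with ⟨⟨a, b⟩, hab⟩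
        simp only at a1 a2
        rcases a with (_ | a) | a <;> rcases b with (_ | b) | b <;>
          first
          | exact absurd a1 (hi _)
          | exact absurd a2 (hi _)
          | simp [bmPos]
      rw [this] at hodd
      obtain ⟨m, hm⟩ := hodd
      omega
  · refine (min_le_right _ _).trans ?_
    obtain ⟨s, p, h1, h2, h3, h4⟩ := bmAng_walk ℓ k w hu
    change w.length = p + negEdgeCount (bmPos ℓ k) w at h3
    obtain ⟨m, hm⟩ := hodd
    have h5 : ((s + 2 * k * p : ℤ) : ZMod (4 * k)) = 0 := by
      push_cast
      linear_combination -h4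
    rw [ZMod.intCast_zmod_eq_zero_iff_dvd] at h5
    obtain ⟨c, hc⟩ := h5
    push_cast at hc
    have hs : s = 2 * (k * (2 * c - p)) := by linear_combination hc
    obtain ⟨q, hq⟩ : ∃ q, p = 2 * q + 1 := ⟨p / 2, by omega⟩
    have hs' : s = (2 * k) * (2 * (c - q) - 1) := by
      rw [hs, hq]; push_cast; ring
    have : (1 : ℤ) ≤ |2 * (c - q) - 1| := Int.one_le_abs (by omega)
    have h6 : (2 * k : ℤ) ≤ |s| := by
      rw [hs', abs_mul, abs_of_nonneg (by positivity)]
      nlinarith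
    omega

theorem bm_isLeast (ℓ k : ℕ) (hℓ : 1 ≤ ℓ) (hk : 2 ≤ k) :
    IsLeast {L : ℕ | ∃ (v : BMVert ℓ k) (w : (BMGraph ℓ k).Walk v v),
        w.IsCycle ∧ Odd (negEdgeCount (bmPos ℓ k) w) ∧ w.length = L}
      (min (2 * ℓ + 2) (2 * k)) := by
  constructor
  · rcases min_choice (2 * ℓ + 2) (2 * k) with h | h <;> rw [h]
    · exact bm_cycle_two ℓ k hℓ hk
    · exact bm_cycle_one ℓ k hℓ hk
  · rintro L ⟨v, w, -, hodd, rfl⟩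
    exact bm_lower ℓ k hℓ w hodd

/-- For integers `ℓ, k ≥ 2`, the length of the shortest negative cycle — a cycle whose sign,
the product of its edge signs, is negative, i.e. one with an odd number of negative edges —
of the signed bipartite graph `BM̂(ℓ, 2k)` equals `min (2ℓ+2) (2k)`; in particular
`BM̂(k-1, 2k)` has `2k² - k + 1` vertices and its shortest negative cycle has length `2k`. -/
theorem negGirth_BM (ℓ k : ℕ) (hℓ : 2 ≤ ℓ) (hk : 2 ≤ k) :
    IsLeast {L : ℕ | ∃ (v : BMVert ℓ k) (w : (BMGraph ℓ k).Walk v v),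
        w.IsCycle ∧ Odd (negEdgeCount (bmPos ℓ k) w) ∧ w.length = L}
      (min (2 * ℓ + 2) (2 * k)) ∧
    Nat.card (BMVert (k - 1) k) = 2 * k ^ 2 - k + 1 ∧
    IsLeast {L : ℕ | ∃ (v : BMVert (k - 1) k) (w : (BMGraph (k - 1) k).Walk v v),
        w.IsCycle ∧ Odd (negEdgeCount (bmPos (k - 1) k) w) ∧ w.length = L}
      (2 * k) := by
  refine ⟨bm_isLeast ℓ k (by omega) hk, ?_, ?_⟩
  · have : NeZero (2 * k) := ⟨by omega⟩
    obtain ⟨m, rfl⟩ : ∃ m, k = m + 2 := ⟨k - 2, by omega⟩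
    rw [Nat.card_eq_fintype_card]
    simp only [Fintype.card_sum, Fintype.card_option, Fintype.card_prod, Fintype.card_fin,
      ZMod.card]
    rw [show m + 2 - 1 = m + 1 by omega,
      show 2 * (m + 2) ^ 2 = ((m + 1) * (2 * (m + 2)) + (m + 2)) + (m + 2) by ring]
    omega
  · have := bm_isLeast (k - 1) k (by omega) hk
    rwa [show min (2 * (k - 1) + 2) (2 * k) = 2 * k by omega] at this
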